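/- Let S be an inverse semigroup and N a normal inverse subsemigroup of S. Suppose s, t ∈ S satisfy s⁻¹ s ≃_N t t⁻¹, and let a, z ∈ N satisfy a a⁻¹ ≤ s⁻¹ s, a⁻¹ a = t t⁻¹, z z⁻¹ ≤ s⁻¹ s, and z⁻¹ z = t t⁻¹. Then s a t ≃_N s z t; that is, the ≃_N-class of s a t does not depend on the choice of the connecting element a ∈ N. -/

import Mathlib

/-- An inverse semigroup: a semigroup in which every element `s` has a
(unique) inverse `s⁻¹` with `s * s⁻¹ * s = s` and `s⁻¹ * s * s⁻¹ = s⁻¹`. -/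
class InverseSemigroup (S : Type*) extends Semigroup S, Inv S where
  mul_inv_mul : ∀ s : S, s * s⁻¹ * s = s
  inv_mul_inv : ∀ s : S, s⁻¹ * s * s⁻¹ = s⁻¹
  inv_unique : ∀ s t : S, s * t * s = s → t * s * t = t → t = s⁻¹

/-- The natural partial order on an inverse semigroup:
`s ≤ t` iff `s = e * t` for some idempotent `e`. -/
def NatLe {S : Type*} [InverseSemigroup S] (s t : S) : Prop :=
  ∃ e : S, IsIdempotentElem e ∧ s = e * t

/-- A normal inverse subsemigroup: a full inverse subsemigroup that is
closed under conjugation. -/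
structure IsNormalInverseSubsemigroup {S : Type*} [InverseSemigroup S] (N : Set S) : Prop where
  mul_mem : ∀ {a b : S}, a ∈ N → b ∈ N → a * b ∈ N
  inv_mem : ∀ {a : S}, a ∈ N → a⁻¹ ∈ N
  full : ∀ {e : S}, IsIdempotentElem e → e ∈ N
  conj_mem : ∀ (s : S) {n : S}, n ∈ N → s⁻¹ * n * s ∈ N

/-- The preorder `≤_N` associated to a normal inverse subsemigroup `N`:
`s ≤_N t` iff there are `a, b ∈ N` with `a⁻¹ * a = s * s⁻¹`,
`s⁻¹ * s = b * b⁻¹` (so `a · s · b` is a trace product) and `a * s * b ≤ t`. -/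
def LeN {S : Type*} [InverseSemigroup S] (N : Set S) (s t : S) : Prop :=
  ∃ a ∈ N, ∃ b ∈ N, a⁻¹ * a = s * s⁻¹ ∧ s⁻¹ * s = b * b⁻¹ ∧ NatLe (a * s * b) t

/-- The equivalence `≃_N` obtained by symmetrizing `≤_N`. -/
def SimeqN {S : Type*} [InverseSemigroup S] (N : Set S) (s t : S) : Prop :=
  LeN N s t ∧ LeN N t s

namespace InverseSemigroup

variable {S : Type*} [InverseSemigroup S]

theorem inv_inv_eq (s : S) : s⁻¹⁻¹ = s :=
  (inv_unique s⁻¹ s (inv_mul_inv s) (mul_inv_mul s)).symm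

theorem inv_eq_of_isIdempotentElem {e : S} (he : IsIdempotentElem e) : e⁻¹ = e :=
  (inv_unique e e (by rw [he.eq, he.eq]) (by rw [he.eq, he.eq])).symm

theorem isIdempotentElem_mul_inv (s : S) : IsIdempotentElem (s * s⁻¹) := by
  rw [IsIdempotentElem, ← mul_assoc, mul_inv_mul]

theorem isIdempotentElem_inv_mul (s : S) : IsIdempotentElem (s⁻¹ * s) := by
  rw [IsIdempotentElem, ← mul_assoc, inv_mul_inv]

theorem isIdempotentElem_mul {e f : S} (he : IsIdempotentElem e) (hf : IsIdempotentElem f) :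
    IsIdempotentElem (e * f) := by
  have he' (y : S) : e * (e * y) = e * y := by rw [← mul_assoc, he.eq]
  have hf' (y : S) : f * (f * y) = f * y := by rw [← mul_assoc, hf.eq]
  obtain ⟨x, hx⟩ : ∃ x, x = (e * f)⁻¹ := ⟨_, rfl⟩
  have h₁ : e * (f * (x * (e * f))) = e * f := by
    simpa only [← hx, mul_assoc] using mul_inv_mul (e * f)
  have h₂ : x * (e * (f * x)) = x := by
    simpa only [← hx, mul_assoc] using inv_mul_inv (e * f)
  have h₃ : f * x * e = x := by
    rw [hx]
    refine inv_unique _ _ ?_ ?_ <;> rw [← hx] <;> simp only [mul_assoc, he', hf']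
    · exact h₁
    · conv_rhs => rw [← h₂]
      simp only [mul_assoc]
  have h₄ : IsIdempotentElem x := by
    have : f * x * e * (f * x * e) = f * x * e := by
      conv_rhs => rw [← h₂]
      simp only [mul_assoc]
    rwa [h₃] at this
  have h₅ : e * f = x := by
    rw [← inv_inv_eq (e * f), ← hx, inv_eq_of_isIdempotentElem h₄]
  rwa [h₅]

/-- Idempotents of an inverse semigroup commute. -/
theorem mul_comm_of_isIdempotentElem {e f : S} (he : IsIdempotentElem e)
    (hf : IsIdempotentElem f) : e * f = f * e := by
  have hef := isIdempotentElem_mul he hf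
  have hfe := isIdempotentElem_mul hf he
  have he' (y : S) : e * (e * y) = e * y := by rw [← mul_assoc, he.eq]
  have hf' (y : S) : f * (f * y) = f * y := by rw [← mul_assoc, hf.eq]
  rw [← inv_eq_of_isIdempotentElem hef]
  refine (inv_unique _ _ ?_ ?_).symm <;> simp only [mul_assoc, he', hf']
  · simpa only [mul_assoc] using hef.eq
  · simpa only [mul_assoc] using hfe.eq

theorem mul_inv_rev_eq (s t : S) : (s * t)⁻¹ = t⁻¹ * s⁻¹ := by
  have h := mul_comm_of_isIdempotentElem (isIdempotentElem_inv_mul s) (isIdempotentElem_mul_inv t)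
  refine (inv_unique _ _ ?_ ?_).symm
  · calc s * t * (t⁻¹ * s⁻¹) * (s * t) = s * (t * t⁻¹ * (s⁻¹ * s)) * t := by simp only [mul_assoc]
      _ = s * s⁻¹ * s * (t * t⁻¹ * t) := by rw [← h]; simp only [mul_assoc]
      _ = s * t := by rw [mul_inv_mul, mul_inv_mul]
  · calc t⁻¹ * s⁻¹ * (s * t) * (t⁻¹ * s⁻¹) = t⁻¹ * (s⁻¹ * s * (t * t⁻¹)) * s⁻¹ := by
          simp only [mul_assoc]
      _ = t⁻¹ * t * t⁻¹ * (s⁻¹ * s * s⁻¹) := by rw [h]; simp only [mul_assoc]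
      _ = t⁻¹ * s⁻¹ := by rw [inv_mul_inv, inv_mul_inv]

theorem natLe_refl (s : S) : NatLe s s :=
  ⟨s * s⁻¹, isIdempotentElem_mul_inv s, (mul_inv_mul s).symm⟩

theorem inv_mul_mul_of_natLe {s a : S} (h : NatLe (a * a⁻¹) (s⁻¹ * s)) : s⁻¹ * (s * a) = a := by
  obtain ⟨e, he, h⟩ := h
  have hs := isIdempotentElem_inv_mul s
  have : s⁻¹ * s * (a * a⁻¹) = a * a⁻¹ := by
    rw [h, mul_comm_of_isIdempotentElem he hs, ← mul_assoc, hs.eq]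
  calc s⁻¹ * (s * a) = s⁻¹ * s * (a * a⁻¹) * a := by
        conv_lhs => rw [← mul_inv_mul a]
        simp only [mul_assoc]
    _ = a := by rw [this, mul_inv_mul]

theorem leN_mul_mul {N : Set S} (hN : IsNormalInverseSubsemigroup N) {s t a z : S}
    (ha : a ∈ N) (ha1 : NatLe (a * a⁻¹) (s⁻¹ * s)) (ha2 : a⁻¹ * a = t * t⁻¹)
    (hz : z ∈ N) (hz1 : NatLe (z * z⁻¹) (s⁻¹ * s)) (hz2 : z⁻¹ * z = t * t⁻¹) :
    LeN N (s * a * t) (s * z * t) := by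
  have hsa := inv_mul_mul_of_natLe ha1
  have hsz := inv_mul_mul_of_natLe hz1
  have hsz' (y : S) : s⁻¹ * (s * (z * y)) = z * y := by
    rw [← mul_assoc s, ← mul_assoc, hsz]
  have hsa' (y : S) : s⁻¹ * (s * (a * y)) = a * y := by
    rw [← mul_assoc s, ← mul_assoc, hsa]
  have hat (y : S) : a⁻¹ * (a * y) = t * (t⁻¹ * y) := by
    rw [← mul_assoc, ha2, mul_assoc]
  have hzt (y : S) : z⁻¹ * (z * y) = t * (t⁻¹ * y) := by
    rw [← mul_assoc, hz2, mul_assoc]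
  have htt : t * (t⁻¹ * t) = t := by rw [← mul_assoc, mul_inv_mul]
  have hmem : s * (z * a⁻¹) * s⁻¹ ∈ N := by
    simpa only [inv_inv_eq] using hN.conj_mem s⁻¹ (hN.mul_mem hz (hN.inv_mem ha))
  have hq := isIdempotentElem_inv_mul t
  refine ⟨_, hmem, t⁻¹ * t, hN.full hq, ?_, ?_, ?_⟩
  · simp only [mul_inv_rev_eq, inv_inv_eq, mul_assoc, hsz', hzt]
  · rw [inv_eq_of_isIdempotentElem hq, hq.eq]
    simp only [mul_inv_rev_eq, mul_assoc, hsa', hat, htt]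
  · have : s * (z * a⁻¹) * s⁻¹ * (s * a * t) * (t⁻¹ * t) = s * z * t := by
      simp only [mul_assoc, hsa', hat, htt]
    rw [this]
    exact natLe_refl _

end InverseSemigroup

/-- The `≃_N`-class of `s * a * t` does not depend on the choice of the
connecting element `a ∈ N`. -/
theorem simeqN_comp_well_defined {S : Type*} [InverseSemigroup S] {N : Set S}
    (hN : IsNormalInverseSubsemigroup N) {s t a z : S}
    (h : SimeqN N (s⁻¹ * s) (t * t⁻¹))
    (ha : a ∈ N) (ha1 : NatLe (a * a⁻¹) (s⁻¹ * s)) (ha2 : a⁻¹ * a = t * t⁻¹)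
    (hz : z ∈ N) (hz1 : NatLe (z * z⁻¹) (s⁻¹ * s)) (hz2 : z⁻¹ * z = t * t⁻¹) :
    SimeqN N (s * a * t) (s * z * t) := by
  exact ⟨InverseSemigroup.leN_mul_mul hN ha ha1 ha2 hz hz1 hz2,
    InverseSemigroup.leN_mul_mul hN hz hz1 hz2 ha ha1 ha2⟩
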